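/- Assume the strictly positive gap condition, C_w < ∞, and the interval support condition with parameter W, and let (f_0, g_0) and (f_1, g_1) be consistent fixed points consisting of nondecreasing interpolating profiles with right-continuous inverses p^{-1}(u) := inf{x : p(x) > u}. Then the function v ↦ f_1^{-1}(v) - f_0^{-1}(v) is constant Lebesgue-almost everywhere on (0,1). -/

import Mathlib

open MeasureTheory Filter Set
open scoped ENNReal

noncomputable section

/-- Convolution `(p ⊗ w)(x) = ∫ p(y) w(x-y) dy`. -/
def convw (p w : ℝ → ℝ) (x : ℝ) : ℝ := ∫ y, p y * w (x - y)

/-- `w` is a window: bounded, nonnegative, even, integrable, normalized. -/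
structure IsWindow (w : ℝ → ℝ) : Prop where
  nonneg : ∀ x, 0 ≤ w x
  even : ∀ x, w (-x) = w x
  bounded : ∃ M, ∀ x, w x ≤ M
  integrable : Integrable w
  normalized : (∫ x, w x) = 1

/-- Generalized inverse `h⁻¹(u) = inf {v ∈ [0,1] : h v > u}`. -/
def geninv (h : ℝ → ℝ) (u : ℝ) : ℝ := sInf {v | v ∈ Icc (0:ℝ) 1 ∧ u < h v}

/-- `h` is an update function: nondecreasing from [0,1] to [0,1] with h 0 = 0, h 1 = 1. -/
def IsUpdate (h : ℝ → ℝ) : Prop :=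
  MonotoneOn h (Icc (0:ℝ) 1) ∧ (∀ v ∈ Icc (0:ℝ) 1, h v ∈ Icc (0:ℝ) 1) ∧ h 0 = 0 ∧ h 1 = 1

/-- The potential function φ(u,v). -/
def pot (hf hg : ℝ → ℝ) (u v : ℝ) : ℝ :=
  (∫ u' in (0:ℝ)..u, geninv hg u') + (∫ v' in (0:ℝ)..v, geninv hf v') - u * v

/-- The positive gap condition. -/
def PGC (hf hg : ℝ → ℝ) : Prop :=
  pot hf hg 1 1 = 0 ∧ ∀ u ∈ Icc (0:ℝ) 1, ∀ v ∈ Icc (0:ℝ) 1, 0 ≤ pot hf hg u v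

/-- The strictly positive gap condition. -/
def SPGC (hf hg : ℝ → ℝ) : Prop :=
  pot hf hg 1 1 = 0 ∧ ∀ u ∈ Icc (0:ℝ) 1, ∀ v ∈ Icc (0:ℝ) 1,
    (u, v) ≠ ((0:ℝ), (0:ℝ)) → (u, v) ≠ ((1:ℝ), (1:ℝ)) → 0 < pot hf hg u v

/-- Interpolating profile: takes values in [0,1], tends to 0 at -∞ and to 1 at +∞. -/
def IsProfile (p : ℝ → ℝ) : Prop :=
  (∀ x, p x ∈ Icc (0:ℝ) 1) ∧ Tendsto p atBot (nhds 0) ∧ Tendsto p atTop (nhds 1)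

/-- `H(t) = ∫_0^t h⁻¹`. -/
def Hfun (h : ℝ → ℝ) (t : ℝ) : ℝ := ∫ v in (0:ℝ)..t, geninv h v

/-- The potential functional `W(f,g)`, valued in [0,∞]. -/
def Wfun (w hf hg f g : ℝ → ℝ) : ℝ≥0∞ :=
  ∫⁻ x, ENNReal.ofReal
    (Hfun hg (g x) + convw (fun y => Hfun hf (f y)) w x - convw f w x * g x)

/-- Saturation of a profile `f` at level `K`. -/
def cut (f : ℝ → ℝ) (K : ℝ) (x : ℝ) : ℝ :=
  (if |x| ≤ K then f x else 0) + (if K < x then 1 else 0)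

/-- Left endpoint of the maximal half-line contained in the level set `{x : p x > t}`. -/
def aT (p : ℝ → ℝ) (t : ℝ) : ℝ := sInf {a : ℝ | Ioi a ⊆ {x | t < p x}}

/-- Increasing rearrangement of an interpolating profile. -/
def rearr (p : ℝ → ℝ) (x : ℝ) : ℝ :=
  (volume {t : ℝ | t ∈ Ioo (0:ℝ) 1 ∧
    aT p t - (volume ({x | t < p x} \ Ioi (aT p t))).toReal < x}).toReal

/-- `Ω(x) = ∫_{-∞}^x w`. -/
def Om (w : ℝ → ℝ) (x : ℝ) : ℝ := ∫ z in Iic x, w z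

/-- The kernel `V(x) = ∫_{-∞}^x Ω`. -/
def Vker (w : ℝ → ℝ) (x : ℝ) : ℝ := ∫ z in Iic x, Om w z

/-- `κ(x) = V(x) - x Ω(x)`. -/
def kap (w : ℝ → ℝ) (x : ℝ) : ℝ := Vker w x - x * Om w x

/-- Right-continuous generalized inverse of a profile. -/
def rinv (p : ℝ → ℝ) (u : ℝ) : ℝ := sInf {x | u < p x}

/-- Displacement interpolant of two nondecreasing interpolating profiles. -/
def dispInterp (p0 p1 : ℝ → ℝ) (l x : ℝ) : ℝ :=
  sInf {u | u ∈ Ioo (0:ℝ) 1 ∧ x < (1 - l) * rinv p0 u + l * rinv p1 u}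

/-- A profile saturated off of the interval [-K,K]. -/
def Saturated (f : ℝ → ℝ) (K : ℝ) : Prop :=
  (∀ x, x < -K → f x = 0) ∧ (∀ x, K < x → f x = 1)

/-- Consistent fixed point. -/
def IsCFP (w hf hg f g : ℝ → ℝ) : Prop :=
  ∀ x, f x ∈ Icc (Function.leftLim hf (convw g w x)) (Function.rightLim hf (convw g w x)) ∧
       g x ∈ Icc (Function.leftLim hg (convw f w x)) (Function.rightLim hg (convw f w x))

/-- Interval support condition with parameter `W ∈ (0,∞]`. -/
def IntervalSupport (w : ℝ → ℝ) (W : ℝ≥0∞) : Prop :=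
  ∀ x : ℝ, (ENNReal.ofReal |x| < W → 0 < w x) ∧ (W < ENNReal.ofReal |x| → w x = 0)

/-- The functional `L(f,g)`. -/
def Lfun (hf hg f g : ℝ → ℝ) : ℝ :=
  ∫ x, ((∫ v in (0:ℝ)..f x, geninv hf v) - ∫ u in (0:ℝ)..g x, (1 - geninv hg u))

/-! ### The cumulative window -/

lemma Om_sub_Om {w : ℝ → ℝ} (hw : IsWindow w) (x y : ℝ) :
    Om w y - Om w x = ∫ z in x..y, w z :=
  intervalIntegral.integral_Iic_sub_Iic hw.integrable.integrableOn hw.integrable.integrableOn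

lemma Om_continuous {w : ℝ → ℝ} (hw : IsWindow w) : Continuous (Om w) := by
  have h : Om w = fun x => Om w 0 + ∫ z in (0:ℝ)..x, w z := by
    funext x
    rw [← Om_sub_Om hw]
    ring
  rw [h]
  exact continuous_const.add
    (intervalIntegral.continuous_primitive (fun _ _ => hw.integrable.intervalIntegrable) 0)

lemma Om_mono {w : ℝ → ℝ} (hw : IsWindow w) : Monotone (Om w) := fun x y hxy => by
  have := intervalIntegral.integral_nonneg (μ := volume) hxy (fun z _ => hw.nonneg z)
  linarith [Om_sub_Om hw x y]

lemma Om_nonneg {w : ℝ → ℝ} (hw : IsWindow w) (x : ℝ) : 0 ≤ Om w x :=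
  integral_nonneg hw.nonneg

lemma setIntegral_Ioi_window {w : ℝ → ℝ} (hw : IsWindow w) (x : ℝ) :
    ∫ z in Ioi x, w z = Om w (-x) := by
  rw [Om, ← integral_comp_neg_Ioi]
  simp [hw.even]

lemma Om_add_Om_neg {w : ℝ → ℝ} (hw : IsWindow w) (x : ℝ) : Om w x + Om w (-x) = 1 := by
  rw [← setIntegral_Ioi_window hw, Om,
    intervalIntegral.integral_Iic_add_Ioi hw.integrable.integrableOn hw.integrable.integrableOn,
    hw.normalized]

lemma Om_le_one {w : ℝ → ℝ} (hw : IsWindow w) (x : ℝ) : Om w x ≤ 1 := by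
  linarith [Om_add_Om_neg hw x, Om_nonneg hw (-x)]

lemma Om_eq_zero {w : ℝ → ℝ} {W : ℝ≥0∞} (hW : W ≠ ⊤) (hw : IsWindow w)
    (hsup : IntervalSupport w W) {x : ℝ} (hx : x ≤ -W.toReal) : Om w x = 0 := by
  have h : ∀ y, y < -W.toReal → Om w y = 0 := fun y hy => by
    refine setIntegral_eq_zero_of_forall_eq_zero fun z hz => (hsup z).2 ?_
    rw [ENNReal.lt_ofReal_iff_toReal_lt hW]
    have : z ≤ y := hz
    linarith [neg_le_abs z]
  refine tendsto_nhds_unique ((Om_continuous hw).continuousAt.tendsto.mono_left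
    (nhdsWithin_le_nhds (s := Iio x))) (tendsto_const_nhds.congr' ?_)
  filter_upwards [self_mem_nhdsWithin] with y hy
  exact (h y (lt_of_lt_of_le hy hx)).symm

lemma Om_lt_Om {w : ℝ → ℝ} {W : ℝ≥0∞} (hw : IsWindow w) (hsup : IntervalSupport w W)
    {c x y : ℝ} (hc : ENNReal.ofReal |c| < W) (hxc : x ≤ c) (hcy : c ≤ y) (hxy : x < y) :
    Om w x < Om w y := by
  have hev : ∀ᶠ z in nhds c, 0 < w z := by
    have : ∀ᶠ z in nhds c, ENNReal.ofReal |z| < W :=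
      
      ContinuousAt.eventually_lt (ENNReal.continuous_ofReal.comp continuous_abs).continuousAt
        continuousAt_const hc
    exact this.mono fun z hz => (hsup z).1 hz
  obtain ⟨ε, hε, hball⟩ := Metric.eventually_nhds_iff.1 hev
  obtain ⟨x', y', hx', hy', hlt, h1, h2⟩ :
      ∃ x' y', x ≤ x' ∧ y' ≤ y ∧ x' < y' ∧ c - ε ≤ x' ∧ y' ≤ c + ε := by
    refine ⟨max x (c - ε), min y (c + ε), le_max_left _ _, min_le_left _ _, ?_,
      le_max_right _ _, min_le_right _ _⟩
    rw [max_lt_iff, lt_min_iff, lt_min_iff]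
    refine ⟨⟨hxy, ?_⟩, ?_, ?_⟩ <;> linarith
  have hpos : 0 < ∫ z in x'..y', w z := by
    refine intervalIntegral.intervalIntegral_pos_of_pos_on
      hw.integrable.intervalIntegrable (fun z hz => hball ?_) hlt
    rw [Real.dist_eq, abs_lt]
    constructor <;> linarith [hz.1, hz.2]
  linarith [Om_sub_Om hw x' y', Om_mono hw hx', Om_mono hw hy']

lemma eq_of_Om_eq {w : ℝ → ℝ} {W : ℝ≥0∞} (hw : IsWindow w) (hsup : IntervalSupport w W)
    {x y : ℝ} (hx : ENNReal.ofReal |x| < W) (h : Om w y = Om w x) : y = x := by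
  rcases lt_trichotomy y x with hlt | heq | hlt
  · exact absurd h (Om_lt_Om hw hsup hx hlt.le le_rfl hlt).ne
  · exact heq
  · exact absurd h.symm (Om_lt_Om hw hsup hx le_rfl hlt.le hlt).ne

/-! ### Right-continuous inverses of profiles -/

lemma rinv_set_bddBelow {p : ℝ → ℝ} (hp : IsProfile p) {u : ℝ} (hu : 0 < u) :
    BddBelow {x | u < p x} := by
  obtain ⟨a, ha⟩ := eventually_atBot.1 (hp.2.1.eventually_lt_const hu)
  exact ⟨a, fun x hx => le_of_not_ge fun hxa => lt_asymm hx (ha x hxa)⟩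

lemma rinv_set_nonempty {p : ℝ → ℝ} (hp : IsProfile p) {u : ℝ} (hu : u < 1) :
    {x | u < p x}.Nonempty :=
  (hp.2.2.eventually_const_lt hu).exists

lemma rinv_le {p : ℝ → ℝ} (hp : IsProfile p) {u x : ℝ} (hu : 0 < u) (h : u < p x) :
    rinv p u ≤ x :=
  csInf_le (rinv_set_bddBelow hp hu) h

lemma lt_of_rinv_lt {p : ℝ → ℝ} (hp : IsProfile p) (hm : Monotone p) {u x : ℝ}
    (hu : u < 1) (h : rinv p u < x) : u < p x := by
  obtain ⟨y, hy, hyx⟩ := exists_lt_of_csInf_lt (rinv_set_nonempty hp hu) h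
  exact lt_of_lt_of_le hy (hm hyx.le)

lemma rinv_monotoneOn {p : ℝ → ℝ} (hp : IsProfile p) : MonotoneOn (rinv p) (Ioo 0 1) :=
  fun _ hu _ hv huv => csInf_le_csInf (rinv_set_bddBelow hp hu.1) (rinv_set_nonempty hp hv.2)
    fun _ hx => lt_of_le_of_lt huv hx

lemma rinv_tendsto_right {p : ℝ → ℝ} (hp : IsProfile p) (hm : Monotone p) {u : ℝ}
    (hu : u ∈ Ioo (0:ℝ) 1) : Tendsto (rinv p) (nhdsWithin u (Ioi u)) (nhds (rinv p u)) := by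
  have hmem : ∀ᶠ u' in nhdsWithin u (Ioi u), u' ∈ Ioo u 1 := Ioo_mem_nhdsGT hu.2
  refine tendsto_order.2 ⟨fun a ha => ?_, fun b hb => ?_⟩
  · filter_upwards [hmem] with u' hu'
    exact lt_of_lt_of_le ha (rinv_monotoneOn hp hu ⟨hu.1.trans hu'.1, hu'.2⟩ hu'.1.le)
  · obtain ⟨c, hc1, hc2⟩ := exists_between hb
    have hc := lt_of_rinv_lt hp hm hu.2 hc1
    filter_upwards [hmem, Ioo_mem_nhdsGT hc] with u' hu' hu''
    exact lt_of_le_of_lt (rinv_le hp (hu.1.trans hu'.1) hu''.2) hc2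

lemma rinv_aemeasurable {p : ℝ → ℝ} (hp : IsProfile p) :
    AEMeasurable (rinv p) (volume.restrict (Ioo 0 1)) :=
  aemeasurable_restrict_of_monotoneOn measurableSet_Ioo (rinv_monotoneOn hp)

/-- The convolution of a monotone profile as an average of the cumulative window. -/
lemma convw_eq {w p : ℝ → ℝ} (hw : IsWindow w) (hp : IsProfile p) (hm : Monotone p) (x : ℝ) :
    convw p w x = ∫ v in Ioo (0:ℝ) 1, Om w (x - rinv p v) := by
  have hwx : Integrable (fun y => w (x - y)) := hw.integrable.comp_sub_left x
  have hS : MeasurableSet {q : ℝ × ℝ | q.1 < p q.2} :=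
    measurableSet_lt measurable_fst (hm.measurable.comp measurable_snd)
  have hint : Integrable (Function.uncurry fun v y => (Iio (p y)).indicator (fun _ => w (x - y)) v)
      ((volume.restrict (Ioo (0:ℝ) 1)).prod volume) := by
    have := (hwx.comp_snd (volume.restrict (Ioo (0:ℝ) 1))).indicator hS
    refine this.congr (Eventually.of_forall fun q => ?_)
    simp [Function.uncurry, indicator]
  have h1 : ∀ y, p y * w (x - y)
      = ∫ v in Ioo (0:ℝ) 1, (Iio (p y)).indicator (fun _ => w (x - y)) v := fun y => by
    rw [setIntegral_indicator measurableSet_Iio, Ioo_inter_Iio, min_eq_right (hp.1 y).2]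
    simp [(hp.1 y).1]
  have h2 : ∀ v ∈ Ioo (0:ℝ) 1,
      ∫ y, (Iio (p y)).indicator (fun _ => w (x - y)) v = Om w (x - rinv p v) := fun v hv => by
    have : ∀ᵐ y, (Iio (p y)).indicator (fun _ => w (x - y)) v
        = (Ioi (rinv p v)).indicator (fun y => w (y - x)) y := by
      have hne : ∀ᵐ y : ℝ, y ≠ rinv p v := by simp [ae_iff]
      filter_upwards [hne] with y hy
      by_cases h : v < p y
      · have := lt_of_le_of_ne (rinv_le hp hv.1 h) hy.symm
        simp [h, this, ← hw.even (y - x)]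
      · have : ¬ rinv p v < y := fun h' => h (lt_of_rinv_lt hp hm hv.2 h')
        simp [h, this]
    have hshift : (fun y => (Ioi (rinv p v)).indicator (fun y => w (y - x)) y)
        = fun y => (Ioi (rinv p v - x)).indicator w (y - x) := by
      funext y
      simp [indicator]
    rw [integral_congr_ae this, hshift, integral_sub_right_eq_self,
      integral_indicator measurableSet_Ioi, setIntegral_Ioi_window hw, neg_sub]
  calc convw p w x
      = ∫ y, ∫ v in Ioo (0:ℝ) 1, (Iio (p y)).indicator (fun _ => w (x - y)) v :=
        integral_congr_ae (Eventually.of_forall h1)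
    _ = ∫ v in Ioo (0:ℝ) 1, ∫ y, (Iio (p y)).indicator (fun _ => w (x - y)) v :=
        (integral_integral_swap hint).symm
    _ = _ := setIntegral_congr_fun measurableSet_Ioo h2

lemma Om_norm_le {w : ℝ → ℝ} (hw : IsWindow w) (x : ℝ) : ‖Om w x‖ ≤ 1 := by
  rw [Real.norm_eq_abs, abs_of_nonneg (Om_nonneg hw x)]
  exact Om_le_one hw x

lemma Om_sub_rinv_integrable {w p : ℝ → ℝ} (hw : IsWindow w) (hp : IsProfile p) (x : ℝ) :
    Integrable (fun v => Om w (x - rinv p v)) (volume.restrict (Ioo (0:ℝ) 1)) :=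
  Integrable.of_bound ((Om_continuous hw).measurable.comp_aemeasurable
    ((rinv_aemeasurable hp).const_sub x)).aestronglyMeasurable 1
    (Eventually.of_forall fun _ => Om_norm_le hw _)

lemma convw_continuous {w p : ℝ → ℝ} (hw : IsWindow w) (hp : IsProfile p) (hm : Monotone p) :
    Continuous (convw p w) := by
  rw [funext (convw_eq hw hp hm)]
  refine continuous_of_dominated (bound := fun _ => 1)
    (fun x => (Om_sub_rinv_integrable hw hp x).aestronglyMeasurable)
    (fun x => Eventually.of_forall fun _ => Om_norm_le hw _) (integrable_const _)
    (Eventually.of_forall fun v => ?_)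
  exact (Om_continuous hw).comp (continuous_id.sub continuous_const)

lemma convw_mem {w p : ℝ → ℝ} (hw : IsWindow w) (hp : IsProfile p) (hm : Monotone p) (x : ℝ) :
    convw p w x ∈ Icc (0:ℝ) 1 := by
  rw [convw_eq hw hp hm]
  refine ⟨integral_nonneg fun v => Om_nonneg hw _, ?_⟩
  calc ∫ v in Ioo (0:ℝ) 1, Om w (x - rinv p v) ≤ ∫ v in Ioo (0:ℝ) 1, (1:ℝ) :=
        integral_mono (Om_sub_rinv_integrable hw hp x) (integrable_const _)
          fun v => Om_le_one hw _
    _ = 1 := by simp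

/-! ### Consistent fixed points through inverses -/

lemma IsUpdate.monotone_clamp {h : ℝ → ℝ} (hh : IsUpdate h) :
    Monotone fun x => h (projIcc (0:ℝ) 1 zero_le_one x) := fun _ _ hxy =>
  hh.1 (Subtype.coe_prop _) (Subtype.coe_prop _) (monotone_projIcc _ hxy)

lemma IsUpdate.le_leftLim {h : ℝ → ℝ} (hh : IsUpdate h) {y c : ℝ} (hy : 0 ≤ y) (hyc : y < c)
    (hc : c ≤ 1) : h y ≤ Function.leftLim h c := by
  have hlim : Function.leftLim h c
      = Function.leftLim (fun x => h (projIcc (0:ℝ) 1 zero_le_one x)) c := by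
    refine leftLim_eq_of_tendsto ((hh.monotone_clamp.tendsto_leftLim c).congr' ?_)
    filter_upwards [Ioo_mem_nhdsLT (lt_of_le_of_lt hy hyc)] with x hx
    rw [projIcc_of_mem _ (⟨hx.1.le, hx.2.le.trans hc⟩ : x ∈ Icc (0:ℝ) 1)]
  rw [hlim]
  have := hh.monotone_clamp.le_leftLim hyc
  rwa [projIcc_of_mem _ (⟨hy, hyc.le.trans hc⟩ : y ∈ Icc (0:ℝ) 1)] at this

lemma IsUpdate.rightLim_le {h : ℝ → ℝ} (hh : IsUpdate h) {y c : ℝ} (hc : 0 ≤ c) (hcy : c < y)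
    (hy : y ≤ 1) : Function.rightLim h c ≤ h y := by
  have hlim : Function.rightLim h c
      = Function.rightLim (fun x => h (projIcc (0:ℝ) 1 zero_le_one x)) c := by
    refine rightLim_eq_of_tendsto ((hh.monotone_clamp.tendsto_rightLim c).congr' ?_)
    filter_upwards [Ioo_mem_nhdsGT (lt_of_lt_of_le hcy hy)] with x hx
    rw [projIcc_of_mem _ (⟨hc.trans hx.1.le, hx.2.le⟩ : x ∈ Icc (0:ℝ) 1)]
  rw [hlim]
  have := hh.monotone_clamp.rightLim_le hcy
  rwa [projIcc_of_mem _ (⟨hc.trans hcy.le, hy⟩ : y ∈ Icc (0:ℝ) 1)] at this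

lemma geninv_le {h : ℝ → ℝ} {u v : ℝ} (hv : v ∈ Icc (0:ℝ) 1) (hu : u < h v) :
    geninv h u ≤ v :=
  csInf_le ⟨0, fun _ hx => hx.1.1⟩ ⟨hv, hu⟩

lemma le_geninv {h : ℝ → ℝ} (hh : IsUpdate h) {u v : ℝ} (hu : u < 1) (hv : v ∈ Icc (0:ℝ) 1)
    (h' : h v ≤ u) : v ≤ geninv h u := by
  refine le_csInf ⟨1, ⟨zero_le_one, le_rfl⟩, by rw [hh.2.2.2]; exact hu⟩ fun x hx => ?_
  by_contra! hlt
  exact absurd (hh.1 hx.1 hv hlt.le) (not_le.2 (lt_of_le_of_lt h' hx.2))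

lemma geninv_eq_of_fixed {h p c : ℝ → ℝ} (hh : IsUpdate h) (hp : IsProfile p) (hm : Monotone p)
    (hc : Continuous c) (hmem : ∀ x, c x ∈ Icc (0:ℝ) 1)
    (hfix : ∀ x, p x ∈ Icc (Function.leftLim h (c x)) (Function.rightLim h (c x)))
    {u : ℝ} (hu : u ∈ Ioo (0:ℝ) 1) : geninv h u = c (rinv p u) := by
  apply le_antisymm
  · refine ge_of_tendsto (hc.continuousAt.tendsto.mono_left
      (nhdsWithin_le_nhds (s := Ioi (rinv p u)))) ?_
    filter_upwards [self_mem_nhdsWithin] with x hx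
    have hux : u < p x := lt_of_rinv_lt hp hm hu.2 hx
    refine le_of_forall_gt_imp_ge_of_dense fun y hy => ?_
    rcases le_or_gt y 1 with hy1 | hy1
    · exact geninv_le ⟨(hmem x).1.trans hy.le, hy1⟩
        (hux.trans_le ((hfix x).2.trans (hh.rightLim_le (hmem x).1 hy hy1)))
    · refine (geninv_le (v := 1) ⟨zero_le_one, le_rfl⟩ ?_).trans hy1.le
      rw [hh.2.2.2]
      exact hu.2
  · refine le_of_tendsto (hc.continuousAt.tendsto.mono_left
      (nhdsWithin_le_nhds (s := Iio (rinv p u)))) ?_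
    filter_upwards [self_mem_nhdsWithin] with x hx
    have hux : p x ≤ u := by
      by_contra! hlt
      exact absurd (rinv_le hp hu.1 hlt) (not_le.2 hx)
    refine le_of_forall_lt_imp_le_of_dense fun y hy => ?_
    rcases le_or_gt 0 y with hy0 | hy0
    · exact le_geninv hh hu.2 ⟨hy0, hy.le.trans (hmem x).2⟩
        ((hh.le_leftLim hy0 hy (hmem x).2).trans ((hfix x).1.trans hux))
    · exact hy0.le.trans (le_geninv hh hu.2 ⟨le_rfl, zero_le_one⟩
        (hh.2.2.1.trans_le hu.1.le))

lemma geninv_eq_integral {w h p q : ℝ → ℝ} (hw : IsWindow w) (hh : IsUpdate h)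
    (hp : IsProfile p) (hpm : Monotone p) (hq : IsProfile q) (hqm : Monotone q)
    (hfix : ∀ x, p x ∈ Icc (Function.leftLim h (convw q w x)) (Function.rightLim h (convw q w x)))
    {u : ℝ} (hu : u ∈ Ioo (0:ℝ) 1) :
    geninv h u = ∫ v in Ioo (0:ℝ) 1, Om w (rinv p u - rinv q v) := by
  rw [geninv_eq_of_fixed hh hp hpm (convw_continuous hw hq hqm) (convw_mem hw hq hqm) hfix hu,
    convw_eq hw hq hqm]

lemma Om_rinv_sub_rinv_integrable {w p q : ℝ → ℝ} (hw : IsWindow w) (hp : IsProfile p)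
    (hq : IsProfile q) {s t : Set ℝ} (hs : s ⊆ Ioo 0 1) (ht : t ⊆ Ioo 0 1) :
    Integrable (fun z : ℝ × ℝ => Om w (rinv p z.1 - rinv q z.2))
      ((volume.restrict s).prod (volume.restrict t)) := by
  have : IsFiniteMeasure (volume.restrict s) :=
    ⟨by simpa using (measure_mono hs).trans_lt (by simp)⟩
  have : IsFiniteMeasure (volume.restrict t) :=
    ⟨by simpa using (measure_mono ht).trans_lt (by simp)⟩
  have hp' : AEMeasurable (fun z : ℝ × ℝ => rinv p z.1)
      ((volume.restrict s).prod (volume.restrict t)) :=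
    ((rinv_aemeasurable hp).mono_measure (Measure.restrict_mono hs le_rfl)).comp_fst
  have hq' : AEMeasurable (fun z : ℝ × ℝ => rinv q z.2)
      ((volume.restrict s).prod (volume.restrict t)) :=
    ((rinv_aemeasurable hq).mono_measure (Measure.restrict_mono ht le_rfl)).comp_snd
  exact Integrable.of_bound ((Om_continuous hw).measurable.comp_aemeasurable
    (hp'.sub hq')).aestronglyMeasurable 1 (Eventually.of_forall fun _ => Om_norm_le hw _)

/-! ### Comparing two fixed points -/

lemma sub_mul_arctan_sub_nonneg {w : ℝ → ℝ} (hw : IsWindow w) (x0 x1 y0 y1 : ℝ) :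
    0 ≤ (Om w (x1 - y1) - Om w (x0 - y0)) * (Real.arctan (x1 - x0) - Real.arctan (y1 - y0)) := by
  rcases le_total (x1 - x0) (y1 - y0) with h | h
  · refine mul_nonneg_of_nonpos_of_nonpos (sub_nonpos.2 (Om_mono hw (by linarith)))
      (sub_nonpos.2 (Real.arctan_strictMono.monotone h))
  · exact mul_nonneg (sub_nonneg.2 (Om_mono hw (by linarith)))
      (sub_nonneg.2 (Real.arctan_strictMono.monotone h))

lemma integral_sub_mul_eq_zero {w h p0 p1 q0 q1 T : ℝ → ℝ} (hw : IsWindow w) (hh : IsUpdate h)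
    (hp0 : IsProfile p0) (hp0m : Monotone p0) (hq0 : IsProfile q0) (hq0m : Monotone q0)
    (hp1 : IsProfile p1) (hp1m : Monotone p1) (hq1 : IsProfile q1) (hq1m : Monotone q1)
    (hfix0 : ∀ x, p0 x ∈
      Icc (Function.leftLim h (convw q0 w x)) (Function.rightLim h (convw q0 w x)))
    (hfix1 : ∀ x, p1 x ∈
      Icc (Function.leftLim h (convw q1 w x)) (Function.rightLim h (convw q1 w x))) :
    ∫ u in Ioo (0:ℝ) 1, ∫ v in Ioo (0:ℝ) 1,
      (Om w (rinv p1 u - rinv q1 v) - Om w (rinv p0 u - rinv q0 v)) * T u = 0 := by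
  refine setIntegral_eq_zero_of_forall_eq_zero fun u hu => ?_
  rw [integral_mul_const, integral_sub (Om_sub_rinv_integrable hw hq1 _)
    (Om_sub_rinv_integrable hw hq0 _), ← geninv_eq_integral hw hh hp1 hp1m hq1 hq1m hfix1 hu,
    ← geninv_eq_integral hw hh hp0 hp0m hq0 hq0m hfix0 hu, sub_self, zero_mul]

lemma Om_ae_eq {w hf hg f0 g0 f1 g1 : ℝ → ℝ} (hw : IsWindow w)
    (hhf : IsUpdate hf) (hhg : IsUpdate hg)
    (hf0 : IsProfile f0) (hg0 : IsProfile g0) (hf1 : IsProfile f1) (hg1 : IsProfile g1)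
    (hf0m : Monotone f0) (hg0m : Monotone g0) (hf1m : Monotone f1) (hg1m : Monotone g1)
    (hcfp0 : IsCFP w hf hg f0 g0) (hcfp1 : IsCFP w hf hg f1 g1) :
    ∀ᵐ z ∂((volume.restrict (Ioo (0:ℝ) 1)).prod (volume.restrict (Ioo (0:ℝ) 1))),
      Om w (rinv g1 z.1 - rinv f1 z.2) = Om w (rinv g0 z.1 - rinv f0 z.2) := by
  set I := volume.restrict (Ioo (0:ℝ) 1) with hI
  set D : ℝ × ℝ → ℝ := fun z =>
    Om w (rinv g1 z.1 - rinv f1 z.2) - Om w (rinv g0 z.1 - rinv f0 z.2) with hD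
  set A : ℝ × ℝ → ℝ := fun z => Real.arctan (rinv g1 z.1 - rinv g0 z.1) with hA
  set B : ℝ × ℝ → ℝ := fun z => Real.arctan (rinv f1 z.2 - rinv f0 z.2) with hB
  have hDint : Integrable D (I.prod I) :=
    (Om_rinv_sub_rinv_integrable hw hg1 hf1 subset_rfl subset_rfl).sub
      (Om_rinv_sub_rinv_integrable hw hg0 hf0 subset_rfl subset_rfl)
  have harctan : ∀ x : ℝ, ‖Real.arctan x‖ ≤ Real.pi / 2 := fun x =>
    abs_le.2 ⟨(Real.neg_pi_div_two_lt_arctan x).le, (Real.arctan_lt_pi_div_two x).le⟩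
  have hAm : AEStronglyMeasurable A (I.prod I) :=
    (Real.measurable_arctan.comp_aemeasurable
      ((rinv_aemeasurable hg1).sub (rinv_aemeasurable hg0)).comp_fst).aestronglyMeasurable
  have hBm : AEStronglyMeasurable B (I.prod I) :=
    (Real.measurable_arctan.comp_aemeasurable
      ((rinv_aemeasurable hf1).sub (rinv_aemeasurable hf0)).comp_snd).aestronglyMeasurable
  have hDA : Integrable (fun z => D z * A z) (I.prod I) :=
    hDint.mul_bdd hAm (Eventually.of_forall fun _ => harctan _)
  have hDB : Integrable (fun z => D z * B z) (I.prod I) :=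
    hDint.mul_bdd hBm (Eventually.of_forall fun _ => harctan _)
  have hDA0 : ∫ z, D z * A z ∂(I.prod I) = 0 := by
    rw [integral_prod _ hDA]
    exact integral_sub_mul_eq_zero hw hhg hg0 hg0m hf0 hf0m hg1 hg1m hf1 hf1m
      (T := fun u => Real.arctan (rinv g1 u - rinv g0 u))
      (fun x => (hcfp0 x).2) (fun x => (hcfp1 x).2)
  have hDB0 : ∫ z, D z * B z ∂(I.prod I) = 0 := by
    rw [integral_prod_symm _ hDB, ← integral_sub_mul_eq_zero hw hhf hf0 hf0m hg0 hg0m hf1 hf1m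
      hg1 hg1m (T := fun v => -Real.arctan (rinv f1 v - rinv f0 v))
      (fun x => (hcfp0 x).1) (fun x => (hcfp1 x).1)]
    refine integral_congr_ae (Eventually.of_forall fun v =>
      integral_congr_ae (Eventually.of_forall fun u => ?_))
    have e1 := Om_add_Om_neg hw (rinv f1 v - rinv g1 u)
    have e0 := Om_add_Om_neg hw (rinv f0 v - rinv g0 u)
    rw [neg_sub] at e0 e1
    simp only [hD, hB, eq_sub_of_add_eq e1, eq_sub_of_add_eq e0]
    ring
  have hzero : ∫ z, D z * (A z - B z) ∂(I.prod I) = 0 := by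
    simp_rw [mul_sub]
    rw [integral_sub hDA hDB, hDA0, hDB0, sub_zero]
  have hint : Integrable (fun z => D z * (A z - B z)) (I.prod I) := by
    simp_rw [mul_sub]
    exact hDA.sub hDB
  have hae := (integral_eq_zero_iff_of_nonneg
    (fun z => sub_mul_arctan_sub_nonneg hw _ _ _ _) hint).1 hzero
  filter_upwards [hae] with z hz
  rcases mul_eq_zero.1 hz with h | h
  · exact sub_eq_zero.1 h
  · have := Real.arctan_injective (sub_eq_zero.1 h)
    congr 1
    linarith

lemma Om_eq_of_ae {w f0 g0 f1 g1 : ℝ → ℝ} (hw : IsWindow w)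
    (hf0 : IsProfile f0) (hg0 : IsProfile g0) (hf1 : IsProfile f1) (hg1 : IsProfile g1)
    (hf0m : Monotone f0) (hg0m : Monotone g0) (hf1m : Monotone f1) (hg1m : Monotone g1)
    (hae : ∀ᵐ z ∂((volume.restrict (Ioo (0:ℝ) 1)).prod (volume.restrict (Ioo (0:ℝ) 1))),
      Om w (rinv g1 z.1 - rinv f1 z.2) = Om w (rinv g0 z.1 - rinv f0 z.2))
    {u v : ℝ} (hu : u ∈ Ioo (0:ℝ) 1) (hv : v ∈ Ioo (0:ℝ) 1) :
    Om w (rinv g1 u - rinv f1 v) = Om w (rinv g0 u - rinv f0 v) := by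
  by_contra hne
  have hlim : ∀ {f g : ℝ → ℝ}, IsProfile f → IsProfile g → Monotone f → Monotone g →
      Tendsto (fun z : ℝ × ℝ => Om w (rinv g z.1 - rinv f z.2))
        (nhdsWithin u (Ioi u) ×ˢ nhdsWithin v (Ioi v)) (nhds (Om w (rinv g u - rinv f v))) :=
    fun hf hg hfm hgm => ((Om_continuous hw).tendsto _).comp
      (((rinv_tendsto_right hg hgm hu).comp tendsto_fst).sub
        ((rinv_tendsto_right hf hfm hv).comp tendsto_snd))
  have hev : ∀ᶠ z in nhdsWithin u (Ioi u) ×ˢ nhdsWithin v (Ioi v),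
      Om w (rinv g1 z.1 - rinv f1 z.2) ≠ Om w (rinv g0 z.1 - rinv f0 z.2) :=
    by
    filter_upwards [((hlim hf1 hg1 hf1m hg1m).sub (hlim hf0 hg0 hf0m hg0m)).eventually_ne
      (sub_ne_zero.2 hne)] with z hz
    exact sub_ne_zero.1 hz
  obtain ⟨s, hs, t, ht, hst⟩ := mem_prod_iff.1 hev
  obtain ⟨u', hu', hsu⟩ := (mem_nhdsGT_iff_exists_Ioo_subset' hu.2).1
    (inter_mem hs (Ioo_mem_nhdsGT hu.2))
  obtain ⟨v', hv', htv⟩ := (mem_nhdsGT_iff_exists_Ioo_subset' hv.2).1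
    (inter_mem ht (Ioo_mem_nhdsGT hv.2))
  have hsub : Ioo u u' ×ˢ Ioo v v' ⊆ {z : ℝ × ℝ |
      ¬ Om w (rinv g1 z.1 - rinv f1 z.2) = Om w (rinv g0 z.1 - rinv f0 z.2)} :=
    fun z hz => hst ⟨(hsu hz.1).1, (htv hz.2).1⟩
  have hnull := measure_mono_null hsub (ae_iff.1 hae)
  have h1 : Ioo u u' ∩ Ioo 0 1 = Ioo u u' := inter_eq_left.2 fun x hx =>
    ⟨hu.1.trans hx.1, (hsu hx).2.2⟩
  have h2 : Ioo v v' ∩ Ioo 0 1 = Ioo v v' := inter_eq_left.2 fun x hx =>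
    ⟨hv.1.trans hx.1, (htv hx).2.2⟩
  rw [Measure.prod_prod, Measure.restrict_apply measurableSet_Ioo,
    Measure.restrict_apply measurableSet_Ioo, h1, h2, Real.volume_Ioo, Real.volume_Ioo,
    mul_eq_zero, ENNReal.ofReal_eq_zero, ENNReal.ofReal_eq_zero] at hnull
  have hu'' : u < u' := hu'
  have hv'' : v < v' := hv'
  rcases hnull with h | h <;> linarith

/-! ### Separated level sets force a zero of the potential -/

lemma integral_geninv_eq {w h p q : ℝ → ℝ} {W : ℝ≥0∞} (hWtop : W ≠ ⊤) (hw : IsWindow w)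
    (hsup : IntervalSupport w W) (hh : IsUpdate h)
    (hp : IsProfile p) (hpm : Monotone p) (hq : IsProfile q) (hqm : Monotone q)
    (hfix : ∀ x, p x ∈ Icc (Function.leftLim h (convw q w x)) (Function.rightLim h (convw q w x)))
    {s t : ℝ} (hs : s ∈ Icc (0:ℝ) 1) (ht : t ∈ Icc (0:ℝ) 1)
    (hsep : ∀ u ∈ Ioo (0:ℝ) 1, ∀ v ∈ Ioo (0:ℝ) 1, u < s → t < v →
      rinv p u - rinv q v ≤ -W.toReal) :
    ∫ u in (0:ℝ)..s, geninv h u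
      = ∫ u in Ioo (0:ℝ) s, ∫ v in Ioo (0:ℝ) t, Om w (rinv p u - rinv q v) := by
  rw [intervalIntegral.integral_of_le hs.1, integral_Ioc_eq_integral_Ioo]
  refine setIntegral_congr_fun measurableSet_Ioo fun u hu => ?_
  have hu1 : u ∈ Ioo (0:ℝ) 1 := ⟨hu.1, hu.2.trans_le hs.2⟩
  refine (geninv_eq_integral hw hh hp hpm hq hqm hfix hu1).trans
    (setIntegral_eq_of_subset_of_ae_sdiff_eq_zero measurableSet_Ioo.nullMeasurableSet
    (Ioo_subset_Ioo_right ht.2) ?_)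
  have hne : ∀ᵐ v : ℝ, v ≠ t := by simp [ae_iff]
  filter_upwards [hne] with v hvt hv
  refine Om_eq_zero hWtop hw hsup (hsep u hu1 v hv.1 hu.2 ?_)
  exact lt_of_le_of_ne (not_lt.1 fun hlt => hv.2 ⟨hv.1.1, hlt⟩) hvt.symm

lemma pot_eq_zero_of_separated {w hf hg f g : ℝ → ℝ} {W : ℝ≥0∞} (hWtop : W ≠ ⊤)
    (hw : IsWindow w) (hsup : IntervalSupport w W) (hhf : IsUpdate hf) (hhg : IsUpdate hg)
    (hfp : IsProfile f) (hfm : Monotone f) (hgp : IsProfile g) (hgm : Monotone g)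
    (hcfp : IsCFP w hf hg f g) {s t : ℝ} (hs : s ∈ Icc (0:ℝ) 1) (ht : t ∈ Icc (0:ℝ) 1)
    (hsep : ∀ u ∈ Ioo (0:ℝ) 1, ∀ v ∈ Ioo (0:ℝ) 1, u < s → t < v →
      rinv g u - rinv f v ≤ -W.toReal)
    (hsep' : ∀ u ∈ Ioo (0:ℝ) 1, ∀ v ∈ Ioo (0:ℝ) 1, s < u → v < t →
      rinv f v - rinv g u ≤ -W.toReal) :
    pot hf hg s t = 0 := by
  have hss : Ioo 0 s ⊆ Ioo 0 1 := Ioo_subset_Ioo_right hs.2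
  have htt : Ioo 0 t ⊆ Ioo 0 1 := Ioo_subset_Ioo_right ht.2
  have hi1 := Om_rinv_sub_rinv_integrable hw hgp hfp hss htt
  have hi2 : Integrable (fun z : ℝ × ℝ => Om w (rinv f z.2 - rinv g z.1))
      ((volume.restrict (Ioo 0 s)).prod (volume.restrict (Ioo 0 t))) :=
    (Om_rinv_sub_rinv_integrable hw hfp hgp htt hss).swap
  rw [pot, integral_geninv_eq hWtop hw hsup hhg hgp hgm hfp hfm (fun x => (hcfp x).2) hs ht hsep,
    integral_geninv_eq hWtop hw hsup hhf hfp hfm hgp hgm (fun x => (hcfp x).1) ht hs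
      fun v hv u hu hvt hsu => hsep' u hu v hv hsu hvt,
    ← integral_prod _ hi1, ← integral_prod_symm _ hi2,
    ← integral_add hi1 hi2]
  have : ∀ z : ℝ × ℝ, Om w (rinv g z.1 - rinv f z.2)
      + Om w (rinv f z.2 - rinv g z.1) = 1 := fun z => by
    simpa using Om_add_Om_neg hw (rinv g z.1 - rinv f z.2)
  rw [integral_congr_ae (Eventually.of_forall this)]
  simp [measureReal_def, Measure.prod_apply, ENNReal.toReal_ofReal, hs.1, ht.1, mul_comm]

/-- Two functions agreeing along all interacting pairs of levels are constant, since a jump would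
separate the level sets. -/
lemma eq_of_interaction {w hf hg f g a b : ℝ → ℝ} {W : ℝ≥0∞} (hWtop : W ≠ ⊤)
    (hw : IsWindow w) (hsup : IntervalSupport w W) (hhf : IsUpdate hf) (hhg : IsUpdate hg)
    (hspgc : SPGC hf hg) (hfp : IsProfile f) (hfm : Monotone f) (hgp : IsProfile g)
    (hgm : Monotone g) (hcfp : IsCFP w hf hg f g)
    (hab : ∀ u ∈ Ioo (0:ℝ) 1, ∀ v ∈ Ioo (0:ℝ) 1, |rinv g u - rinv f v| < W.toReal → a u = b v)
    {v1 v2 : ℝ} (hv1 : v1 ∈ Ioo (0:ℝ) 1) (hv2 : v2 ∈ Ioo (0:ℝ) 1) (hlt : v1 < v2) :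
    b v1 = b v2 := by
  by_contra hne
  have hF := rinv_monotoneOn hfp
  have hG := rinv_monotoneOn hgp
  set V : Set ℝ := {v | v ∈ Ioo (0:ℝ) 1 ∧ ∀ v' ∈ Icc v1 v, b v' = b v1} with hV
  set U : Set ℝ := {u | u ∈ Ioo (0:ℝ) 1 ∧ ∃ v ∈ V, rinv g u < rinv f v + W.toReal} with hU
  have hv1V : v1 ∈ V := ⟨hv1, fun v' hv' => by rw [le_antisymm hv'.2 hv'.1]⟩
  have hVlt : ∀ v ∈ V, v < v2 := fun v hv => by
    by_contra! h
    exact hne (hv.2 v2 ⟨hlt.le, h⟩).symm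
  have hVlower : ∀ v ∈ V, ∀ v' ∈ Ioo (0:ℝ) 1, v' ≤ v → v' ∈ V := fun v hv v' hv' hle =>
    ⟨hv', fun x hx => hv.2 x ⟨hx.1, hx.2.trans hle⟩⟩
  have hUlower : ∀ u ∈ U, ∀ u' ∈ Ioo (0:ℝ) 1, u' ≤ u → u' ∈ U := by
    rintro u ⟨hu, v, hv, h⟩ u' hu' hle
    exact ⟨hu', v, hv, (hG hu' hu hle).trans_lt h⟩
  have hsep : ∀ u ∈ U, ∀ v ∈ Ioo (0:ℝ) 1, v ∉ V → rinv g u - rinv f v ≤ -W.toReal := by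
    rintro u ⟨hu, v', hv', h⟩ v hv hvV
    by_contra! hgt
    have hv'v : v' < v := by
      by_contra! hle
      exact hvV (hVlower v' hv' v hv hle)
    have hadj : ∀ x ∈ Icc v' v, a u = b x := fun x hx => by
      have hx1 : x ∈ Ioo (0:ℝ) 1 := ⟨hv'.1.1.trans_le hx.1, hx.2.trans_lt hv.2⟩
      refine hab u hu x hx1 (abs_lt.2 ⟨?_, ?_⟩)
      · linarith [hF hx1 hv hx.2]
      · linarith [hF hv'.1 hx1 hx.1]
    have hau : a u = b v1 := by
      rcases le_total v1 v' with hle | hle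
      · rw [hadj v' ⟨le_rfl, hv'v.le⟩, hv'.2 v' ⟨hle, le_rfl⟩]
      · refine hadj v1 ⟨hle, ?_⟩
        by_contra! hvv1
        exact hvV (hVlower v1 hv1V v hv hvv1.le)
    refine hvV ⟨hv, fun x hx => ?_⟩
    rcases le_total x v' with hle | hle
    · exact hv'.2 x ⟨hx.1, hle⟩
    · rw [← hadj x ⟨hle, hx.2⟩, hau]
  have hsep' : ∀ u ∈ Ioo (0:ℝ) 1, u ∉ U → ∀ v ∈ V, rinv f v - rinv g u ≤ -W.toReal := by
    intro u hu huU v hv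
    by_contra! hgt
    exact huU ⟨hu, v, hv, by linarith⟩
  have hVbdd : BddAbove V := ⟨v2, fun v hv => (hVlt v hv).le⟩
  have hUbdd : BddAbove (insert 0 U) := ⟨1, by
    rintro u (rfl | hu)
    · exact zero_le_one
    · exact hu.1.2.le⟩
  have hs : sSup (insert 0 U) ∈ Icc (0:ℝ) 1 :=
    ⟨le_csSup hUbdd (mem_insert _ _), csSup_le (insert_nonempty _ _) (by
      rintro u (rfl | hu)
      · exact zero_le_one
      · exact hu.1.2.le)⟩
  have ht0 : 0 < sSup V := hv1.1.trans_le (le_csSup hVbdd hv1V)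
  have ht1 : sSup V < 1 := (csSup_le ⟨v1, hv1V⟩ fun v hv => (hVlt v hv).le).trans_lt hv2.2
  have memV : ∀ v ∈ Ioo (0:ℝ) 1, v < sSup V → v ∈ V := fun v hv h => by
    obtain ⟨x, hx, hvx⟩ := exists_lt_of_lt_csSup ⟨v1, hv1V⟩ h
    exact hVlower x hx v hv hvx.le
  have memU : ∀ u ∈ Ioo (0:ℝ) 1, u < sSup (insert 0 U) → u ∈ U := fun u hu h => by
    obtain ⟨x, rfl | hx, hux⟩ := exists_lt_of_lt_csSup (insert_nonempty _ _) h
    · exact absurd hu.1 hux.not_gt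
    · exact hUlower x hx u hu hux.le
  have hpot := pot_eq_zero_of_separated hWtop hw hsup hhf hhg hfp hfm hgp hgm hcfp hs
    ⟨ht0.le, ht1.le⟩
    (fun u hu v hv hus hvt => hsep u (memU u hu hus) v hv fun h => (le_csSup hVbdd h).not_gt hvt)
    (fun u hu v hv hus hvt => hsep' u hu
      (fun h => (le_csSup hUbdd (mem_insert_of_mem _ h)).not_gt hus) v (memV v hv hvt))
  refine (hspgc.2 _ hs _ ⟨ht0.le, ht1.le⟩ (fun h => ?_) (fun h => ?_)).ne' hpot
  · exact ht0.ne' (Prod.ext_iff.1 h).2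
  · exact ht1.ne (Prod.ext_iff.1 h).2

/-- Under the SPGC, `C_w < ∞` and the interval support condition with
parameter `W`, if `(f₀,g₀)` and `(f₁,g₁)` are consistent fixed points of nondecreasing
interpolating profiles, then `v ↦ f₁⁻¹(v) - f₀⁻¹(v)` is constant a.e. on `(0,1)`. -/
theorem stmt17 (w hf hg f0 g0 f1 g1 : ℝ → ℝ) (W : ℝ≥0∞) (hW : 0 < W)
    (hw : IsWindow w) (hCw : Integrable (fun x => |x| * w x))
    (hsup : IntervalSupport w W)
    (hhf : IsUpdate hf) (hhg : IsUpdate hg) (hspgc : SPGC hf hg)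
    (hf0 : IsProfile f0) (hg0 : IsProfile g0) (hf1 : IsProfile f1) (hg1 : IsProfile g1)
    (hf0m : Monotone f0) (hg0m : Monotone g0) (hf1m : Monotone f1) (hg1m : Monotone g1)
    (hcfp0 : IsCFP w hf hg f0 g0) (hcfp1 : IsCFP w hf hg f1 g1) :
    ∃ c : ℝ, ∀ᵐ v ∂(volume.restrict (Ioo (0:ℝ) 1)), rinv f1 v - rinv f0 v = c := by
  have hOm : ∀ u ∈ Ioo (0:ℝ) 1, ∀ v ∈ Ioo (0:ℝ) 1,
      Om w (rinv g1 u - rinv f1 v) = Om w (rinv g0 u - rinv f0 v) := fun u hu v hv =>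
    Om_eq_of_ae hw hf0 hg0 hf1 hg1 hf0m hg0m hf1m hg1m
      (Om_ae_eq hw hhf hhg hf0 hg0 hf1 hg1 hf0m hg0m hf1m hg1m hcfp0 hcfp1) hu hv
  have hadj : ∀ u ∈ Ioo (0:ℝ) 1, ∀ v ∈ Ioo (0:ℝ) 1,
      ENNReal.ofReal |rinv g0 u - rinv f0 v| < W →
        rinv g1 u - rinv g0 u = rinv f1 v - rinv f0 v := fun u hu v hv h => by
    have := eq_of_Om_eq hw hsup h (hOm u hu v hv)
    linarith
  have hhalf : (1 / 2 : ℝ) ∈ Ioo (0:ℝ) 1 := by norm_num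
  refine ⟨rinv f1 (1 / 2) - rinv f0 (1 / 2), ae_restrict_of_forall_mem measurableSet_Ioo ?_⟩
  intro v hv
  by_cases hWtop : W = ⊤
  · have hall : ∀ x ∈ Ioo (0:ℝ) 1, _ := fun x hx =>
      hadj (1 / 2) hhalf x hx (hWtop ▸ ENNReal.ofReal_lt_top)
    rw [← hall v hv, ← hall _ hhalf]
  have key : ∀ {v1 v2 : ℝ}, v1 ∈ Ioo (0:ℝ) 1 → v2 ∈ Ioo (0:ℝ) 1 → v1 < v2 →
      rinv f1 v1 - rinv f0 v1 = rinv f1 v2 - rinv f0 v2 :=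
    eq_of_interaction (a := fun u => rinv g1 u - rinv g0 u)
      (b := fun v => rinv f1 v - rinv f0 v) hWtop hw hsup hhf hhg hspgc hf0 hf0m hg0 hg0m hcfp0
      fun u hu v hv h => hadj u hu v hv ((ENNReal.ofReal_lt_iff_lt_toReal (abs_nonneg _) hWtop).2 h)
  rcases lt_trichotomy v (1 / 2) with h | h | h
  · exact key hv hhalf h
  · rw [h]
  · exact (key hhalf hv h).symm

end
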